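/- For every delta > 0 there exist constants c_delta, C_delta > 0 such that for every finite Abelian group G with |G| ≥ 2 and every integer k ≥ (2 + delta)·d(G), if Z_1, ..., Z_k are i.i.d. uniform on G, then P( t_rel^*(G^−(Z)) ≤ C_delta·|G|^{2/k} ) ≥ 1 − C_delta·2^{−k/c_delta}. -/

import Mathlib

/-- Transition matrix of the simple random walk on the undirected Cayley multigraph of the
finite additive Abelian group `G` with generator tuple `z`:
`P(x,y) = (2k)⁻¹·(#{i : y = x + z i} + #{i : y = x − z i})`. -/
noncomputable def cayP {G : Type*} [AddCommGroup G] [Fintype G] [DecidableEq G] {k : ℕ}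
    (z : Fin k → G) (x y : G) : ℝ :=
  (((Finset.univ.filter fun i => y = x + z i).card : ℝ) +
    ((Finset.univ.filter fun i => y = x - z i).card : ℝ)) / (2 * k)

/-- The second-largest eigenvalue `λ₂` of a symmetric stochastic matrix `P` on `G`,
via the variational characterisation over mean-zero functions. -/
noncomputable def lamTwo {G : Type*} [Fintype G] (P : G → G → ℝ) : ℝ :=
  sSup {r : ℝ | ∃ f : G → ℝ, f ≠ 0 ∧ (∑ x, f x) = 0 ∧
    r = (∑ x, ∑ y, f x * P x y * f y) / (∑ x, (f x) ^ 2)}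

/-- The smallest eigenvalue `λ_{|G|}` of a symmetric stochastic matrix `P` on `G`,
via the variational characterisation. -/
noncomputable def lamMin {G : Type*} [Fintype G] (P : G → G → ℝ) : ℝ :=
  sInf {r : ℝ | ∃ f : G → ℝ, f ≠ 0 ∧
    r = (∑ x, ∑ y, f x * P x y * f y) / (∑ x, (f x) ^ 2)}

/-- The absolute spectral gap `γ_* = 1 − max{|λ₂|, |λ_{|G|}|}`. -/
noncomputable def absSpectralGap {G : Type*} [Fintype G] (P : G → G → ℝ) : ℝ :=
  1 - max |lamTwo P| |lamMin P|

/-- Minimal size of a generating subset of the additive group `G`. -/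
noncomputable def minGenAdd (G : Type*) [AddCommGroup G] : ℕ :=
  sInf {n : ℕ | ∃ s : Finset G, s.card = n ∧ AddSubgroup.closure (s : Set G) = ⊤}

/-- Probability, over a uniformly random `k`-tuple of elements of `G`, of the event `p`. -/
noncomputable def tupleProb (G : Type*) [Fintype G] (k : ℕ) (p : (Fin k → G) → Prop) : ℝ :=
  (Nat.card {z : Fin k → G // p z} : ℝ) / (Fintype.card G : ℝ) ^ k

section Spectral

open Finset ComplexConjugate

variable {G : Type*} [AddCommGroup G] [Fintype G]

/-- Fourier expansion of the autocorrelation of a real function on a finite Abelian group. -/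
lemma card_mul_autocorrelation (f : G → ℝ) (a : G) :
    (Fintype.card G : ℝ) * ∑ x, f x * f (x + a) =
      ∑ χ : AddChar G ℂ, ‖∑ x, (f x : ℂ) * χ x‖ ^ 2 * (χ a).re := by
  classical
  have key : (Fintype.card G : ℂ) * ∑ x, (f x : ℂ) * f (x + a) =
      ∑ χ : AddChar G ℂ, ((‖∑ x, (f x : ℂ) * χ x‖ ^ 2 : ℝ) : ℂ) * χ a := by
    have h1 : ∀ χ : AddChar G ℂ, ((‖∑ x, (f x : ℂ) * χ x‖ ^ 2 : ℝ) : ℂ) * χ a =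
        ∑ x, ∑ y, (f x : ℂ) * f y * χ (x - y + a) := by
      intro χ
      rw [Complex.ofReal_pow, ← Complex.mul_conj', map_sum, sum_mul_sum, sum_mul]
      refine sum_congr rfl fun x _ => ?_
      rw [sum_mul]
      refine sum_congr rfl fun y _ => ?_
      rw [map_mul, Complex.conj_ofReal, AddChar.map_add_eq_mul, sub_eq_add_neg,
        AddChar.map_add_eq_mul, AddChar.map_neg_eq_conj]
      ring
    simp_rw [h1]
    rw [sum_comm, mul_sum]
    refine sum_congr rfl fun x _ => ?_
    rw [sum_comm]
    simp_rw [← mul_sum, AddChar.sum_apply_eq_ite]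
    rw [sum_eq_single (x + a)]
    · simp; ring
    · intro y _ hy
      rw [if_neg, mul_zero]
      intro h
      exact hy (by rw [← sub_eq_zero, ← neg_eq_zero, ← h]; abel)
    · simp
  have := congrArg Complex.re key
  rw [Complex.re_sum] at this
  simp_rw [Complex.re_ofReal_mul] at this
  rw [← this]
  norm_cast

lemma AddChar.re_neg (χ : AddChar G ℂ) (a : G) : (χ (-a)).re = (χ a).re := by
  rw [AddChar.map_neg_eq_conj, Complex.conj_re]

lemma card_mul_sum_sq (f : G → ℝ) :
    (Fintype.card G : ℝ) * ∑ x, f x ^ 2 =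
      ∑ χ : AddChar G ℂ, ‖∑ x, (f x : ℂ) * χ x‖ ^ 2 := by
  simpa [sq] using card_mul_autocorrelation f 0

variable [DecidableEq G]

/-- The quadratic form of the walk, diagonalised by the characters of the group. -/
lemma card_mul_quadForm_cayP {k : ℕ} (z : Fin k → G) (f : G → ℝ) :
    (Fintype.card G : ℝ) * ∑ x, ∑ y, f x * cayP z x y * f y =
      ∑ χ : AddChar G ℂ, ‖∑ x, (f x : ℂ) * χ x‖ ^ 2 * ((∑ i, (χ (z i)).re) / k) := by
  have h1 : ∑ x, ∑ y, f x * cayP z x y * f y =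
      (∑ i, (∑ x, f x * f (x + z i) + ∑ x, f x * f (x + -z i))) / (2 * k) := by
    have h2 : ∀ x, ∑ y, f x * cayP z x y * f y =
        (∑ i, (f x * f (x + z i) + f x * f (x + -z i))) / (2 * k) := by
      intro x
      have h3 : ∀ y, f x * cayP z x y * f y =
          (∑ i, ((if y = x + z i then f x * f y else 0) +
            (if y = x - z i then f x * f y else 0))) / (2 * k) := by
        intro y
        simp only [cayP, card_filter, Nat.cast_sum, sum_add_distrib]
        rw [mul_div_assoc', div_mul_eq_mul_div, mul_add, add_mul, mul_sum, mul_sum, sum_mul,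
          sum_mul]
        congr 2 <;> refine sum_congr rfl fun i _ => ?_ <;> split_ifs <;> simp
      simp_rw [h3]
      rw [← sum_div, sum_comm]
      congr 1
      refine sum_congr rfl fun i _ => ?_
      rw [sum_add_distrib]
      simp [sub_eq_add_neg]
    simp_rw [h2]
    rw [← sum_div, sum_comm]
    simp_rw [sum_add_distrib]
  rw [h1, ← mul_div_assoc, mul_sum]
  simp_rw [mul_add, card_mul_autocorrelation, AddChar.re_neg, ← two_mul]
  rw [← mul_sum, mul_div_mul_left _ _ two_ne_zero, sum_comm, sum_div]
  simp_rw [← mul_sum, mul_div_assoc]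

/-- If all nontrivial character sums of the generators are at most `1 - ε` in absolute value,
then the absolute spectral gap is at least `ε`. -/
lemma le_absSpectralGap_cayP {k : ℕ} (hk : 0 < k) (hG : 2 ≤ Fintype.card G) (z : Fin k → G)
    {ε : ℝ} (h : ∀ χ : AddChar G ℂ, χ ≠ 0 → |∑ i, (χ (z i)).re| ≤ (1 - ε) * k) :
    ε ≤ absSpectralGap (cayP z) := by
  have hk' : (0 : ℝ) < k := by exact_mod_cast hk
  have hN : (0 : ℝ) < Fintype.card G := by exact_mod_cast (by omega : 0 < Fintype.card G)
  have hpos : ∀ f : G → ℝ, f ≠ 0 → 0 < ∑ x, f x ^ 2 := by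
    intro f hf
    obtain ⟨x, hx⟩ := Function.ne_iff.mp hf
    exact sum_pos' (fun _ _ => sq_nonneg _) ⟨x, mem_univ _, sq_pos_of_ne_zero hx⟩
  have hdiv : ∀ χ : AddChar G ℂ, χ ≠ 0 → |(∑ i, (χ (z i)).re) / k| ≤ 1 - ε := by
    intro χ hχ
    rw [abs_div, abs_of_pos hk', div_le_iff₀ hk']
    exact h χ hχ
  have hε : 0 ≤ 1 - ε := by
    have : Nontrivial G := Fintype.one_lt_card_iff_nontrivial.mp hG
    obtain ⟨a, ha⟩ := exists_ne (0 : G)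
    obtain ⟨χ, hχ⟩ := AddChar.exists_apply_ne_zero.mpr ha
    refine (abs_nonneg _).trans (hdiv χ ?_)
    rintro rfl
    exact hχ (by simp)
  have hlow : ∀ f : G → ℝ, f ≠ 0 →
      -(1 - ε) ≤ (∑ x, ∑ y, f x * cayP z x y * f y) / (∑ x, (f x) ^ 2) := by
    intro f hf
    rw [le_div_iff₀ (hpos f hf)]
    refine le_of_mul_le_mul_left ?_ hN
    rw [card_mul_quadForm_cayP, mul_left_comm, card_mul_sum_sq, mul_sum]
    refine sum_le_sum fun χ _ => ?_
    rw [mul_comm]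
    refine mul_le_mul_of_nonneg_left ?_ (by positivity)
    by_cases hχ : χ = 0
    · subst hχ
      simp only [AddChar.zero_apply, Complex.one_re, sum_const, card_univ, Fintype.card_fin,
        nsmul_eq_mul, mul_one, div_self hk'.ne']
      linarith
    · exact (abs_le.mp (hdiv χ hχ)).1
  have hup : ∀ f : G → ℝ, f ≠ 0 → (∑ x, f x) = 0 →
      (∑ x, ∑ y, f x * cayP z x y * f y) / (∑ x, (f x) ^ 2) ≤ 1 - ε := by
    intro f hf hf0
    rw [div_le_iff₀ (hpos f hf)]
    refine le_of_mul_le_mul_left ?_ hN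
    rw [card_mul_quadForm_cayP, mul_left_comm, card_mul_sum_sq, mul_sum]
    refine sum_le_sum fun χ _ => ?_
    rw [mul_comm (1 - ε)]
    by_cases hχ : χ = 0
    · subst hχ
      have : ∑ x, (f x : ℂ) = 0 := by exact_mod_cast hf0
      simp [this]
    · exact mul_le_mul_of_nonneg_left (abs_le.mp (hdiv χ hχ)).2 (by positivity)
  obtain ⟨f, hf, hf0⟩ : ∃ f : G → ℝ, f ≠ 0 ∧ (∑ x, f x) = 0 := by
    have : Nontrivial G := Fintype.one_lt_card_iff_nontrivial.mp hG
    obtain ⟨a, ha⟩ := exists_ne (0 : G)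
    refine ⟨fun x => (if x = 0 then 1 else 0) - (if x = a then 1 else 0), ?_, by simp⟩
    intro h0
    simpa [ha.symm] using congrFun h0 0
  have h2 : |lamTwo (cayP z)| ≤ 1 - ε := by
    rw [abs_le, lamTwo]
    constructor
    · refine (hlow f hf).trans (le_csSup ⟨1 - ε, ?_⟩ ⟨f, hf, hf0, rfl⟩)
      rintro r ⟨g, hg, hg0, rfl⟩
      exact hup g hg hg0
    · refine csSup_le ⟨_, f, hf, hf0, rfl⟩ ?_
      rintro r ⟨g, hg, hg0, rfl⟩
      exact hup g hg hg0
  have h3 : |lamMin (cayP z)| ≤ 1 - ε := by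
    rw [abs_le, lamMin]
    constructor
    · refine le_csInf ⟨_, f, hf, rfl⟩ ?_
      rintro r ⟨g, hg, rfl⟩
      exact hlow g hg
    · refine le_trans (csInf_le ?_ ⟨f, hf, rfl⟩) (hup f hf hf0)
      refine ⟨-(1 - ε), ?_⟩
      rintro r ⟨g, hg, rfl⟩
      exact hlow g hg
  have := max_le h2 h3
  unfold absSpectralGap
  linarith

end Spectral

section CharacterMoments

open Finset

variable {G : Type*} [AddCommGroup G]

/-- The number of values of an additive character. -/
noncomputable def AddChar.valueCard (χ : AddChar G ℂ) : ℕ :=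
  Nat.card χ.toMonoidHom.toHomUnits.range

lemma AddChar.apply_pow_valueCard (χ : AddChar G ℂ) (x : G) : χ x ^ χ.valueCard = 1 := by
  have h := pow_card_eq_one' (G := χ.toMonoidHom.toHomUnits.range)
    (x := ⟨_, ⟨Multiplicative.ofAdd x, rfl⟩⟩)
  simpa [valueCard] using congrArg (fun u : χ.toMonoidHom.toHomUnits.range => ((u : ℂˣ) : ℂ)) h

variable [Fintype G]

lemma AddChar.valueCard_pos (χ : AddChar G ℂ) : 0 < χ.valueCard := Nat.card_pos

lemma AddChar.valueCard_le_card (χ : AddChar G ℂ) : χ.valueCard ≤ Fintype.card G := by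
  rw [← Nat.card_eq_fintype_card]
  exact Nat.card_le_card_of_surjective (α := Multiplicative G) _
    χ.toMonoidHom.toHomUnits.rangeRestrict_surjective

lemma AddChar.two_le_valueCard {χ : AddChar G ℂ} (hχ : χ ≠ 0) : 2 ≤ χ.valueCard := by
  have h0 := χ.valueCard_pos
  by_contra! h
  have h1 : χ.valueCard = 1 := by omega
  refine hχ (DFunLike.ext _ _ fun x => ?_)
  simpa [h1] using χ.apply_pow_valueCard x

/-- Sum over the group of a function of a character, as a sum over the values. -/
lemma AddChar.valueCard_mul_sum (χ : AddChar G ℂ) (F : ℂ → ℝ) :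
    (χ.valueCard : ℝ) * ∑ x, F (χ x) =
      Fintype.card G * ∑ᶠ u : χ.toMonoidHom.toHomUnits.range, F ((u : ℂˣ) : ℂ) := by
  classical
  have : Fintype χ.toMonoidHom.toHomUnits.range := Fintype.ofFinite _
  rw [finsum_eq_sum_of_fintype, AddChar.valueCard, Nat.card_eq_fintype_card]
  have h1 : ∀ u : χ.toMonoidHom.toHomUnits.range,
      ∑ x, F (χ x) = ∑ x, F (χ x * ((u : ℂˣ) : ℂ)) := by
    rintro ⟨_, ⟨y, rfl⟩⟩
    rw [← Equiv.sum_comp (Equiv.addRight y.toAdd)]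
    simp [AddChar.map_add_eq_mul]
  have h2 : ∀ x : G, ∑ u : χ.toMonoidHom.toHomUnits.range, F (χ x * ((u : ℂˣ) : ℂ)) =
      ∑ u : χ.toMonoidHom.toHomUnits.range, F ((u : ℂˣ) : ℂ) := by
    intro x
    exact Equiv.sum_comp (Equiv.mulLeft (⟨_, ⟨Multiplicative.ofAdd x, rfl⟩⟩ :
      χ.toMonoidHom.toHomUnits.range)) fun u => F ((u : ℂˣ) : ℂ)
  calc _ = ∑ u : χ.toMonoidHom.toHomUnits.range, ∑ x, F (χ x) := by simp
    _ = ∑ u : χ.toMonoidHom.toHomUnits.range, ∑ x, F (χ x * ((u : ℂˣ) : ℂ)) :=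
      sum_congr rfl fun u _ => h1 u
    _ = _ := by rw [sum_comm]; simp_rw [h2]; simp

lemma sum_exp_neg_mul_succ_le {a : ℝ} (ha : 0 < a) (n : ℕ) :
    ∑ j ∈ range n, Real.exp (-(a * (j + 1 : ℕ))) ≤ 1 / a := by
  have hq : Real.exp (-a) < 1 := by rw [Real.exp_lt_one_iff]; linarith
  have h0 := Real.exp_pos (-a)
  have h1 : ∑ j ∈ range n, Real.exp (-(a * (j + 1 : ℕ))) =
      Real.exp (-a) * ∑ j ∈ range n, Real.exp (-a) ^ j := by
    rw [mul_sum]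
    refine sum_congr rfl fun j _ => ?_
    rw [← pow_succ', ← Real.exp_nat_mul]
    congr 1; ring
  have h2 : ∑ j ∈ range n, Real.exp (-a) ^ j ≤ (1 - Real.exp (-a))⁻¹ := by
    rw [← tsum_geometric_of_lt_one h0.le hq]
    exact (summable_geometric_of_lt_one h0.le hq).sum_le_tsum _ fun _ _ => by positivity
  rw [h1]
  refine (mul_le_mul_of_nonneg_left h2 h0.le).trans ?_
  rw [← div_eq_mul_inv, div_le_div_iff₀ (by linarith) ha]
  have h3 := Real.add_one_le_exp a
  have h4 : Real.exp (-a) * Real.exp a = 1 := by rw [← Real.exp_add]; simp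
  nlinarith

/-- Gaussian-type bound for the Gibbs weight at a root of unity close to `1`. -/
lemma exp_neg_one_sub_cos_le {s m x : ℝ} (hm : 0 < m) (hx : 0 ≤ x)
    (hxm : 2 * x ≤ m) :
    Real.exp (-(s ^ 2 * (1 - Real.cos (2 * Real.pi * (x / m))))) ≤
      4 / 3 * Real.exp (-(2 * s / m * x)) := by
  have hpi := Real.pi_pos
  have hle : x / m ≤ 1 / 2 := by rw [div_le_div_iff₀ hm two_pos]; linarith
  have h0 : 0 ≤ x / m := by positivity
  have hcos := Real.cos_le_one_sub_mul_cos_sq (x := 2 * Real.pi * (x / m)) (by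
    rw [abs_of_nonneg (by positivity)]; nlinarith)
  have h1 : 2 / Real.pi ^ 2 * (2 * Real.pi * (x / m)) ^ 2 = 8 * (x / m) ^ 2 := by
    field_simp; ring
  rw [h1] at hcos
  have h2 : Real.exp (1 / 4) ≤ 4 / 3 := by
    have h3 := Real.add_one_le_exp (-(1 / 4) : ℝ)
    have h4 : Real.exp (-(1 / 4)) * Real.exp (1 / 4) = 1 := by rw [← Real.exp_add]; simp
    nlinarith [Real.exp_pos (1 / 4)]
  have h5 : 2 * s / m * x = 2 * s * (x / m) := by ring
  calc _ ≤ Real.exp (1 / 4 + -(2 * s / m * x)) := by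
        apply Real.exp_le_exp.mpr
        rw [h5]
        nlinarith [sq_nonneg (2 * s * (x / m) - 1 / 2), sq_nonneg s, sq_nonneg (s * (x / m)),
          mul_le_mul_of_nonneg_left hcos (sq_nonneg s)]
    _ = Real.exp (1 / 4) * Real.exp (-(2 * s / m * x)) := Real.exp_add _ _
    _ ≤ _ := mul_le_mul_of_nonneg_right h2 (Real.exp_pos _).le

lemma sum_range_exp_neg_one_sub_cos_le {s : ℝ} (hs : 0 < s) {m : ℕ} (hm : 0 < m) :
    ∑ j ∈ range m, Real.exp (-(s ^ 2 * (1 - Real.cos (2 * Real.pi * ((j : ℝ) / m))))) ≤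
      1 + 2 * m / s := by
  obtain ⟨n, rfl⟩ : ∃ n, m = n + 1 := ⟨m - 1, by omega⟩
  set M : ℝ := ((n + 1 : ℕ) : ℝ) with hM
  have hM0 : 0 < M := by positivity
  set a := 2 * s / M with ha
  have ha0 : 0 < a := by positivity
  have hterm : ∀ j ∈ range n,
      Real.exp (-(s ^ 2 * (1 - Real.cos (2 * Real.pi * (((j + 1 : ℕ) : ℝ) / M))))) ≤
      4 / 3 * Real.exp (-(a * (j + 1 : ℕ))) +
        4 / 3 * Real.exp (-(a * ((n - 1 - j + 1 : ℕ) : ℝ))) := by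
    intro j hj
    have hjn := mem_range.mp hj
    have e1 := Real.exp_pos (-(a * (j + 1 : ℕ)))
    have e2 := Real.exp_pos (-(a * ((n - 1 - j + 1 : ℕ) : ℝ)))
    rcases le_total (2 * (j + 1)) (n + 1) with h | h
    · have := exp_neg_one_sub_cos_le (s := s) (x := ((j + 1 : ℕ) : ℝ)) hM0 (by positivity)
        (by rw [hM]; exact_mod_cast h)
      linarith
    · have hsum : ((n - 1 - j + 1 : ℕ) : ℝ) = M - ((j + 1 : ℕ) : ℝ) := by
        rw [hM, eq_sub_iff_add_eq]; norm_cast; omega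
      have hcos : Real.cos (2 * Real.pi * (((j + 1 : ℕ) : ℝ) / M)) =
          Real.cos (2 * Real.pi * (((n - 1 - j + 1 : ℕ) : ℝ) / M)) := by
        rw [hsum, ← Real.cos_two_pi_sub]
        congr 1; field_simp
      have := exp_neg_one_sub_cos_le (s := s) (x := ((n - 1 - j + 1 : ℕ) : ℝ)) hM0
        (by positivity) (by rw [hM]; norm_cast; omega)
      rw [hcos]
      linarith
  rw [sum_range_succ']
  have h1 := sum_le_sum hterm
  rw [sum_add_distrib, ← mul_sum, ← mul_sum,
    sum_range_reflect (fun j => Real.exp (-(a * ((j + 1 : ℕ) : ℝ)))) n] at h1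
  have h2 := sum_exp_neg_mul_succ_le ha0 n
  have h3 : 1 / a = M / (2 * s) := by rw [ha]; field_simp
  have h4 : M / s = 2 * (M / (2 * s)) := by field_simp
  have h5 : 0 ≤ M / s := by positivity
  simp only [Nat.cast_zero, zero_div, mul_zero, Real.cos_zero, sub_self, neg_zero, Real.exp_zero]
  rw [mul_div_assoc]
  linarith

/-- Exponential moment bound for a character evaluated at a uniform group element. -/
lemma AddChar.sum_exp_neg_le (χ : AddChar G ℂ) {s : ℝ} (hs : 0 < s) :
    ∑ x, Real.exp (-(s ^ 2 * (1 - (χ x).re))) ≤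
      Fintype.card G * (1 / χ.valueCard + 2 / s) := by
  classical
  have : Fintype χ.toMonoidHom.toHomUnits.range := Fintype.ofFinite _
  have hm := χ.valueCard_pos
  have : NeZero χ.valueCard := ⟨hm.ne'⟩
  have hm' : (0 : ℝ) < χ.valueCard := by exact_mod_cast hm
  have hex : ∀ u : χ.toMonoidHom.toHomUnits.range, ∃ j < χ.valueCard,
      Complex.exp (2 * Real.pi * Complex.I * (j / χ.valueCard)) = ((u : ℂˣ) : ℂ) := by
    intro u
    refine (Complex.mem_rootsOfUnity _ _).mp ?_
    rw [mem_rootsOfUnity]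
    obtain ⟨_, ⟨y, rfl⟩⟩ := u
    ext
    simpa using χ.apply_pow_valueCard y.toAdd
  choose j hj hje using hex
  have hinj : Function.Injective j := by
    intro u v huv
    ext
    rw [← hje u, ← hje v, huv]
  have hre : ∀ u : χ.toMonoidHom.toHomUnits.range,
      (((u : ℂˣ) : ℂ)).re = Real.cos (2 * Real.pi * ((j u : ℝ) / χ.valueCard)) := by
    intro u
    rw [← hje u, ← Complex.exp_ofReal_mul_I_re]
    congr 2
    push_cast
    ring
  have h1 : ∑ u : χ.toMonoidHom.toHomUnits.range,
      Real.exp (-(s ^ 2 * (1 - (((u : ℂˣ) : ℂ)).re))) ≤ 1 + 2 * χ.valueCard / s := by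
    refine le_trans ?_ (sum_range_exp_neg_one_sub_cos_le hs hm)
    simp_rw [hre]
    rw [← sum_image (s := univ) (g := j) (f := fun i : ℕ =>
      Real.exp (-(s ^ 2 * (1 - Real.cos (2 * Real.pi * ((i : ℝ) / χ.valueCard))))))
      hinj.injOn]
    refine sum_le_sum_of_subset_of_nonneg ?_ fun _ _ _ => (Real.exp_pos _).le
    intro i hi
    obtain ⟨u, _, rfl⟩ := mem_image.mp hi
    exact mem_range.mpr (hj u)
  have h2 := χ.valueCard_mul_sum fun w => Real.exp (-(s ^ 2 * (1 - w.re)))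
  rw [finsum_eq_sum_of_fintype] at h2
  refine le_of_mul_le_mul_left ?_ hm'
  rw [h2, mul_left_comm]
  refine mul_le_mul_of_nonneg_left (h1.trans_eq ?_) (Nat.cast_nonneg _)
  field_simp

end CharacterMoments

section Counting

open Finset

lemma exists_card_eq_minGenAdd (G : Type*) [AddCommGroup G] [Fintype G] :
    ∃ S : Finset G, S.card = minGenAdd G ∧ AddSubgroup.closure (S : Set G) = ⊤ :=
  Nat.sInf_mem (s := {n : ℕ | ∃ s : Finset G, s.card = n ∧
    AddSubgroup.closure (s : Set G) = ⊤}) ⟨_, univ, rfl, by simp⟩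

lemma AddChar.eq_of_eqOn_of_closure_eq_top {G : Type*} [AddCommGroup G] {S : Set G} (hS : AddSubgroup.closure S = ⊤)
    {χ ψ : AddChar G ℂ} (h : ∀ x ∈ S, χ x = ψ x) : χ = ψ := by
  refine DFunLike.ext _ _ fun x => ?_
  have hx : x ∈ AddSubgroup.closure S := by simp [hS]
  induction hx using AddSubgroup.closure_induction with
  | mem x hx => exact h x hx
  | zero => simp
  | add x y _ _ hx hy => rw [AddChar.map_add_eq_mul, AddChar.map_add_eq_mul, hx, hy]
  | neg x _ hx => rw [AddChar.map_neg_eq_inv, AddChar.map_neg_eq_inv, hx]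

/-- Exponential Markov inequality for sums of i.i.d. uniform coordinates. -/
lemma card_filter_sum_lt_le {G : Type*} [Fintype G] {k : ℕ} (g : G → ℝ) {t : ℝ} (ht : 0 ≤ t) (r : ℝ) :
    ((univ.filter fun Z : Fin k → G => ∑ i, g (Z i) < r).card : ℝ) ≤
      Real.exp (t * r) * (∑ x, Real.exp (-(t * g x))) ^ k := by
  classical
  rw [Fintype.sum_pow, mul_sum, card_eq_sum_ones, Nat.cast_sum, sum_filter]
  refine sum_le_sum fun Z _ => ?_
  rw [← Real.exp_sum, ← Real.exp_add, sum_neg_distrib, ← mul_sum, ← sub_eq_add_neg, ← mul_sub]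
  split_ifs with h
  · simp only [Nat.cast_one]
    exact Real.one_le_exp (mul_nonneg ht (by linarith))
  · exact (Real.exp_pos _).le

variable {G : Type*} [AddCommGroup G] [Fintype G]

lemma minGenAdd_pos (hG : 2 ≤ Fintype.card G) : 0 < minGenAdd G := by
  obtain ⟨S, hS, hcl⟩ := exists_card_eq_minGenAdd G
  rw [← hS, card_pos, nonempty_iff_ne_empty]
  rintro rfl
  have : Nontrivial G := Fintype.one_lt_card_iff_nontrivial.mp hG
  rw [coe_empty, AddSubgroup.closure_empty] at hcl
  exact bot_ne_top hcl

lemma AddChar.card_filter_valueCard_eq_le (m : ℕ) :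
    (univ.filter fun χ : AddChar G ℂ => χ.valueCard = m).card ≤ m ^ minGenAdd G := by
  classical
  obtain ⟨S, hS, hcl⟩ := exists_card_eq_minGenAdd G
  calc _ ≤ (Fintype.piFinset fun _ : S => Polynomial.nthRootsFinset m (1 : ℂ)).card := by
        refine card_le_card_of_injOn (fun χ s => χ s) ?_ ?_
        · intro χ hχ
          have hχ : χ.valueCard = m := by simpa using hχ
          subst hχ
          simp only [Fintype.coe_piFinset, Set.mem_pi, mem_coe]
          intro s _
          rw [Polynomial.mem_nthRootsFinset χ.valueCard_pos]
          exact χ.apply_pow_valueCard s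
        · intro χ _ ψ _ h
          exact AddChar.eq_of_eqOn_of_closure_eq_top hcl fun x hx => congrFun h ⟨x, hx⟩
    _ ≤ m ^ minGenAdd G := by
        rw [Fintype.card_piFinset, prod_const, card_univ, Fintype.card_coe, hS]
        refine Nat.pow_le_pow_left ?_ _
        exact (Multiset.toFinset_card_le _).trans (Polynomial.card_nthRoots m 1)

lemma AddChar.sum_one_div_valueCard_pow_le {k : ℕ} (hk : minGenAdd G + 2 ≤ k) :
    ∑ χ ∈ univ.filter (fun χ : AddChar G ℂ => χ ≠ 0), (1 / χ.valueCard : ℝ) ^ k ≤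
      4 * (1 / 2) ^ (k - minGenAdd G) := by
  classical
  obtain ⟨e, rfl⟩ := Nat.exists_eq_add_of_le hk
  have hmaps : ∀ χ ∈ univ.filter (fun χ : AddChar G ℂ => χ ≠ 0),
      χ.valueCard ∈ Ioc 1 (Fintype.card G) := by
    intro χ hχ
    exact mem_Ioc.mpr ⟨AddChar.two_le_valueCard (by simpa using hχ), χ.valueCard_le_card⟩
  rw [← sum_fiberwise_of_maps_to hmaps]
  have hterm : ∀ m ∈ Ioc 1 (Fintype.card G),
      ∑ χ ∈ (univ.filter (fun χ : AddChar G ℂ => χ ≠ 0)).filter (fun χ => χ.valueCard = m),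
        (1 / χ.valueCard : ℝ) ^ (minGenAdd G + 2 + e) ≤ (1 / 2) ^ e * ((m : ℝ) ^ 2)⁻¹ := by
    intro m hm
    have hm1 := (mem_Ioc.mp hm).1
    have hm2 : (2 : ℝ) ≤ m := by exact_mod_cast hm1
    have hm0 : (0 : ℝ) < m := by linarith
    have hcard : (((univ.filter (fun χ : AddChar G ℂ => χ ≠ 0)).filter
        (fun χ => χ.valueCard = m)).card : ℝ) ≤ (m : ℝ) ^ minGenAdd G := by
      exact_mod_cast (card_le_card (filter_subset_filter _ (filter_subset _ _))).trans
        (AddChar.card_filter_valueCard_eq_le (G := G) m)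
    calc _ = ∑ χ ∈ (univ.filter (fun χ : AddChar G ℂ => χ ≠ 0)).filter
          (fun χ => χ.valueCard = m), (1 / m : ℝ) ^ (minGenAdd G + 2 + e) :=
          sum_congr rfl fun χ hχ => by rw [(mem_filter.mp hχ).2]
      _ ≤ (m : ℝ) ^ minGenAdd G * (1 / m : ℝ) ^ (minGenAdd G + 2 + e) := by
          rw [sum_const, nsmul_eq_mul]
          gcongr
      _ = (1 / m : ℝ) ^ e * ((m : ℝ) ^ 2)⁻¹ := by
          simp only [pow_add, one_div, inv_pow]; field_simp
      _ ≤ _ := by gcongr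
  refine (sum_le_sum hterm).trans ?_
  rw [← mul_sum]
  have hsum : ∑ m ∈ Ioc 1 (Fintype.card G), ((m : ℝ) ^ 2)⁻¹ ≤ 1 := by
    refine (sum_Ioc_inv_sq_le_sub one_ne_zero Fintype.card_pos).trans ?_
    have : (0 : ℝ) ≤ ((Fintype.card G : ℕ) : ℝ)⁻¹ := by positivity
    simp
  have hexp : minGenAdd G + 2 + e - minGenAdd G = e + 2 := by omega
  rw [hexp, pow_add]
  have : (0 : ℝ) ≤ (1 / 2) ^ e := by positivity
  nlinarith

lemma AddChar.re_add_self (χ : AddChar G ℂ) (x : G) :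
    ((χ + χ) x).re = 2 * (χ x).re ^ 2 - 1 := by
  have h : (χ x).re * (χ x).re + (χ x).im * (χ x).im = 1 := by
    rw [← Complex.normSq_apply, Complex.normSq_eq_norm_sq, AddChar.norm_apply, one_pow]
  rw [AddChar.add_apply, Complex.mul_re]
  linarith

lemma AddChar.sum_exp_neg_one_add_re {χ : AddChar G ℂ} (hχ : χ ≠ 0) (h2 : χ + χ = 0) (t : ℝ) :
    ∑ x, Real.exp (-(t * (1 + (χ x).re))) = ∑ x, Real.exp (-(t * (1 - (χ x).re))) := by
  obtain ⟨y, hy⟩ : ∃ y, χ y ≠ 1 := by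
    by_contra! h
    exact hχ (DFunLike.ext _ _ fun x => by simpa using h x)
  have hy2 : χ y * χ y = 1 := by rw [← AddChar.add_apply, h2, AddChar.zero_apply]
  have hy3 : χ y = -1 := (mul_self_eq_one_iff.mp hy2).resolve_left hy
  rw [← Equiv.sum_comp (Equiv.addRight y)]
  simp [AddChar.map_add_eq_mul, hy3, sub_eq_add_neg]

/-- Lower bounds on `1 - λ_χ` for nontrivial `χ`, and on `1 + λ_χ` only for `χ` of order two,
suffice for the absolute gap, since `1 - λ_{2χ} ≤ 4 (1 + λ_χ)`. -/
lemma le_absSpectralGap_of_forall_addChar [DecidableEq G] {k : ℕ} (hk : 0 < k)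
    (hG : 2 ≤ Fintype.card G) (z : Fin k → G) {ε : ℝ} (hε : 0 ≤ ε)
    (h1 : ∀ χ : AddChar G ℂ, χ ≠ 0 → ε * k ≤ ∑ i, (1 - (χ (z i)).re))
    (h2 : ∀ χ : AddChar G ℂ, χ ≠ 0 → χ + χ = 0 → ε * k ≤ ∑ i, (1 + (χ (z i)).re)) :
    ε / 4 ≤ absSpectralGap (cayP z) := by
  have hεk : 0 ≤ ε * k := by positivity
  refine le_absSpectralGap_cayP hk hG z fun χ hχ => abs_le.mpr ⟨?_, ?_⟩
  · by_cases hχ2 : χ + χ = 0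
    · have := h2 χ hχ hχ2
      simp only [sum_add_distrib, sum_const, card_univ, Fintype.card_fin, nsmul_eq_mul,
        mul_one] at this
      linarith
    · have h3 : ∑ i, (1 - ((χ + χ) (z i)).re) ≤ ∑ i, 4 * (1 + (χ (z i)).re) := by
        refine sum_le_sum fun i _ => ?_
        rw [AddChar.re_add_self]
        nlinarith [sq_nonneg (1 + (χ (z i)).re)]
      have := (h1 _ hχ2).trans h3
      rw [← mul_sum] at this
      simp only [sum_add_distrib, sum_const, card_univ, Fintype.card_fin, nsmul_eq_mul,
        mul_one] at this
      linarith
  · have := h1 χ hχ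
    simp only [sum_sub_distrib, sum_const, card_univ, Fintype.card_fin, nsmul_eq_mul,
      mul_one] at this
    linarith

/-- Union bound over the nontrivial characters for the failure of the spectral gap bound. -/
lemma card_filter_absSpectralGap_lt_le [DecidableEq G] {k : ℕ} (hk : 0 < k)
    (hG : 2 ≤ Fintype.card G) {s ε : ℝ} (hs : 0 < s) (hε : 0 ≤ ε) :
    ((univ.filter fun Z : Fin k → G => absSpectralGap (cayP Z) < ε / 4).card : ℝ) ≤
      (Fintype.card G : ℝ) ^ k * (2 * Real.exp (s ^ 2 * ε) ^ k *
        ∑ χ ∈ univ.filter (fun χ : AddChar G ℂ => χ ≠ 0), (1 / χ.valueCard + 2 / s) ^ k) := by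
  classical
  set N : ℝ := (Fintype.card G : ℝ) with hN
  set A : AddChar G ℂ → Finset (Fin k → G) := fun χ =>
    univ.filter fun Z => ∑ i, (1 - (χ (Z i)).re) < ε * k with hA
  set B : AddChar G ℂ → Finset (Fin k → G) := fun χ =>
    univ.filter fun Z => χ + χ = 0 ∧ ∑ i, (1 + (χ (Z i)).re) < ε * k with hB
  have hexp : Real.exp (s ^ 2 * (ε * k)) = Real.exp (s ^ 2 * ε) ^ k := by
    rw [← Real.exp_nat_mul]; congr 1; ring
  have hmom : ∀ χ : AddChar G ℂ,
      Real.exp (s ^ 2 * (ε * k)) * (∑ x, Real.exp (-(s ^ 2 * (1 - (χ x).re)))) ^ k ≤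
        Real.exp (s ^ 2 * ε) ^ k * (N * (1 / χ.valueCard + 2 / s)) ^ k := by
    intro χ
    rw [hexp]
    exact mul_le_mul_of_nonneg_left (pow_le_pow_left₀ (sum_nonneg fun _ _ => (Real.exp_pos _).le)
      (χ.sum_exp_neg_le hs) k) (by positivity)
  have hAcard : ∀ χ : AddChar G ℂ, ((A χ).card : ℝ) ≤
      Real.exp (s ^ 2 * ε) ^ k * (N * (1 / χ.valueCard + 2 / s)) ^ k := fun χ =>
    (card_filter_sum_lt_le (fun x => 1 - (χ x).re) (sq_nonneg s) _).trans (hmom χ)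
  have hBcard : ∀ χ : AddChar G ℂ, χ ≠ 0 → ((B χ).card : ℝ) ≤
      Real.exp (s ^ 2 * ε) ^ k * (N * (1 / χ.valueCard + 2 / s)) ^ k := by
    intro χ hχ
    by_cases h2 : χ + χ = 0
    · refine le_trans ?_ (hmom χ)
      rw [← AddChar.sum_exp_neg_one_add_re hχ h2]
      simpa [hB, h2] using card_filter_sum_lt_le (fun x => 1 + (χ x).re) (sq_nonneg s) (ε * k)
    · have : B χ = ∅ := by simp [hB, h2]
      rw [this, card_empty, Nat.cast_zero]
      positivity
  have hsub : (univ.filter fun Z : Fin k → G => absSpectralGap (cayP Z) < ε / 4) ⊆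
      (univ.filter (fun χ : AddChar G ℂ => χ ≠ 0)).biUnion fun χ => A χ ∪ B χ := by
    intro Z hZ
    by_contra hnot
    simp only [hA, hB, mem_biUnion, mem_filter, mem_univ, true_and, mem_union, not_exists,
      not_and, not_or, not_lt] at hnot
    exact not_le.mpr (mem_filter.mp hZ).2 (le_absSpectralGap_of_forall_addChar hk hG Z hε
      (fun χ hχ => (hnot χ hχ).1) fun χ hχ => (hnot χ hχ).2)
  calc _ ≤ ((∑ χ ∈ univ.filter (fun χ : AddChar G ℂ => χ ≠ 0),
        ((A χ).card + (B χ).card) : ℕ) : ℝ) := by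
        exact_mod_cast (card_le_card hsub).trans
          (card_biUnion_le.trans (sum_le_sum fun χ _ => card_union_le _ _))
    _ ≤ ∑ χ ∈ univ.filter (fun χ : AddChar G ℂ => χ ≠ 0),
        2 * (Real.exp (s ^ 2 * ε) ^ k * (N * (1 / χ.valueCard + 2 / s)) ^ k) := by
        push_cast
        refine sum_le_sum fun χ hχ => ?_
        have := hAcard χ
        have := hBcard χ (mem_filter.mp hχ).2
        linarith
    _ = _ := by
        rw [mul_sum, mul_sum]
        refine sum_congr rfl fun χ _ => ?_
        rw [mul_pow]; ring

end Counting

lemma add_pow_le_of_eleven_tenths {x y : ℝ} (hx : 0 ≤ x) (hy : 0 ≤ y) (k : ℕ) :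
    (x + y) ^ k ≤ (11 / 10) ^ k * x ^ k + 11 ^ k * y ^ k := by
  rw [← mul_pow, ← mul_pow]
  rcases le_total (10 * y) x with h | h
  · have h1 : (x + y) ^ k ≤ (11 / 10 * x) ^ k := pow_le_pow_left₀ (by positivity) (by linarith) k
    have h2 : 0 ≤ (11 * y) ^ k := by positivity
    linarith
  · have h1 : (x + y) ^ k ≤ (11 * y) ^ k := pow_le_pow_left₀ (by positivity) (by linarith) k
    have h2 : 0 ≤ (11 / 10 * x) ^ k := by positivity
    linarith

lemma pow_mul_half_pow_le {k e : ℕ} (h : k ≤ 2 * e) :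
    (121 / 100 : ℝ) ^ k * (1 / 2) ^ e ≤ (2 : ℝ) ^ (-((k : ℝ) / 5)) := by
  have h1 : (121 / 100 : ℝ) ≤ 2 ^ (3 / 10 : ℝ) := by
    refine le_of_pow_le_pow_left₀ (n := 10) (by norm_num) (by positivity) ?_
    rw [← Real.rpow_mul_natCast (by norm_num)]
    norm_num
  have h2 : (1 / 2 : ℝ) ^ e = 2 ^ (-(e : ℝ)) := by
    rw [Real.rpow_neg (by norm_num), Real.rpow_natCast, one_div, inv_pow]
  have h3 : (k : ℝ) ≤ 2 * e := by exact_mod_cast h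
  calc _ ≤ ((2 : ℝ) ^ (3 / 10 : ℝ)) ^ k * 2 ^ (-(e : ℝ)) := by rw [h2]; gcongr
    _ = 2 ^ (3 / 10 * (k : ℝ) + -(e : ℝ)) := by
        rw [← Real.rpow_mul_natCast (by norm_num), Real.rpow_add (by norm_num)]
    _ ≤ _ := Real.rpow_le_rpow_of_exponent_le (by norm_num) (by linarith)

lemma pow_le_two_rpow_neg_div_five (k : ℕ) :
    (121 / 250 : ℝ) ^ k ≤ (2 : ℝ) ^ (-((k : ℝ) / 5)) := by
  calc (121 / 250 : ℝ) ^ k ≤ (1 / 2) ^ k := pow_le_pow_left₀ (by norm_num) (by norm_num) k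
    _ = 2 ^ (-(k : ℝ)) := by
        rw [Real.rpow_neg (by norm_num), Real.rpow_natCast, one_div, inv_pow]
    _ ≤ _ := Real.rpow_le_rpow_of_exponent_le (by norm_num) (by
        have : (0 : ℝ) ≤ k := Nat.cast_nonneg k
        linarith)

open Finset in
lemma sum_one_div_valueCard_add_pow_le {G : Type*} [AddCommGroup G] [Fintype G] {k : ℕ}
    (hk : 2 * minGenAdd G < k) (hk2 : minGenAdd G + 2 ≤ k) {y : ℝ} (hy : 0 ≤ y)
    (hyk : (Fintype.card G : ℝ) * y ^ k ≤ (1 / 25) ^ k) :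
    (11 / 10) ^ k * ∑ χ ∈ univ.filter (fun χ : AddChar G ℂ => χ ≠ 0),
      (1 / χ.valueCard + y) ^ k ≤ 5 * (2 : ℝ) ^ (-((k : ℝ) / 5)) := by
  have hcard : ((univ.filter (fun χ : AddChar G ℂ => χ ≠ 0)).card : ℝ) ≤ Fintype.card G := by
    exact_mod_cast (card_le_univ _).trans AddChar.card_eq.le
  have h1 : ∑ χ ∈ univ.filter (fun χ : AddChar G ℂ => χ ≠ 0), (1 / χ.valueCard + y) ^ k ≤
      (11 / 10) ^ k * (4 * (1 / 2) ^ (k - minGenAdd G)) + 11 ^ k * (1 / 25) ^ k := by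
    refine (sum_le_sum fun χ _ =>
      add_pow_le_of_eleven_tenths (x := 1 / (χ.valueCard : ℝ)) (by positivity) hy k).trans ?_
    rw [sum_add_distrib, ← mul_sum, sum_const, nsmul_eq_mul]
    refine add_le_add (mul_le_mul_of_nonneg_left (AddChar.sum_one_div_valueCard_pow_le hk2)
      (by positivity)) ?_
    rw [mul_left_comm]
    refine mul_le_mul_of_nonneg_left ?_ (by positivity)
    exact (mul_le_mul_of_nonneg_right hcard (by positivity)).trans hyk
  have h2 : (11 / 10 : ℝ) ^ k * (11 / 10) ^ k = (121 / 100) ^ k := by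
    rw [← mul_pow]; norm_num
  have h3 : (11 / 10 : ℝ) ^ k * (11 ^ k * (1 / 25) ^ k) = (121 / 250) ^ k := by
    rw [← mul_pow, ← mul_pow]; norm_num
  have h4 := pow_mul_half_pow_le (k := k) (e := k - minGenAdd G) (by omega)
  have h5 := pow_le_two_rpow_neg_div_five k
  calc _ ≤ (11 / 10 : ℝ) ^ k * ((11 / 10) ^ k * (4 * (1 / 2) ^ (k - minGenAdd G)) +
        11 ^ k * (1 / 25) ^ k) := mul_le_mul_of_nonneg_left h1 (by positivity)
    _ = 4 * ((121 / 100) ^ k * (1 / 2) ^ (k - minGenAdd G)) + (121 / 250) ^ k := by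
        rw [← h2, ← h3]; ring
    _ ≤ _ := by linarith

/-- `t_rel^*(G^-(Z)) ≤ C_δ·|G|^{2/k}`, stated equivalently as
`γ_*(G^-(Z)) ≥ C_δ⁻¹·|G|^{−2/k}`, with probability at least `1 − C_δ·2^{−k/c_δ}`. -/
theorem statement7 :
    ∀ δ : ℝ, 0 < δ →
    ∃ c C : ℝ, 0 < c ∧ 0 < C ∧
    ∀ (G : Type) [AddCommGroup G] [Fintype G] [DecidableEq G],
      2 ≤ Fintype.card G →
      ∀ k : ℕ, (2 + δ) * (minGenAdd G : ℝ) ≤ (k : ℝ) →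
        1 - C * (2 : ℝ) ^ (-((k : ℝ) / c)) ≤
          tupleProb G k (fun Z =>
            C⁻¹ * (Fintype.card G : ℝ) ^ (-(2 / (k : ℝ))) ≤ absSpectralGap (cayP Z)) := by
  intro δ hδ
  refine ⟨5, 110000, by norm_num, by norm_num, ?_⟩
  intro G _ _ _ hG k hkδ
  have hd := minGenAdd_pos hG
  have hd' : (0 : ℝ) < minGenAdd G := by exact_mod_cast hd
  have hk : 2 * minGenAdd G < k := by
    have : (2 : ℝ) * minGenAdd G < k := by nlinarith
    exact_mod_cast this
  have hk0 : k ≠ 0 := by omega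
  have hk' : (k : ℝ) ≠ 0 := by exact_mod_cast hk0
  set N : ℝ := (Fintype.card G : ℝ) with hNdef
  have hN : 0 < N := by rw [hNdef]; exact_mod_cast (by omega : 0 < Fintype.card G)
  set s : ℝ := 50 * N ^ (1 / (k : ℝ)) with hs
  have hs0 : 0 < s := by positivity
  set ε : ℝ := 1 / 11 / s ^ 2 with hε
  have hsε : s ^ 2 * ε = 1 / 11 := by rw [hε]; field_simp
  have hthr : (110000 : ℝ)⁻¹ * N ^ (-(2 / (k : ℝ))) = ε / 4 := by
    have h1 : (N ^ (1 / (k : ℝ))) ^ 2 = N ^ (2 / (k : ℝ)) := by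
      rw [← Real.rpow_mul_natCast hN.le]
      congr 1; push_cast; ring
    rw [hε, hs, mul_pow, h1, Real.rpow_neg hN.le]
    field_simp
    norm_num
  have hexp : Real.exp (1 / 11) ≤ 11 / 10 := by
    have h3 := Real.add_one_le_exp (-(1 / 11) : ℝ)
    have h4 : Real.exp (-(1 / 11)) * Real.exp (1 / 11) = 1 := by rw [← Real.exp_add]; simp
    nlinarith [Real.exp_pos (1 / 11)]
  have hy : N * (2 / s) ^ k ≤ (1 / 25) ^ k := by
    have h1 : s ^ k = 50 ^ k * N := by
      rw [hs, mul_pow, one_div, Real.rpow_inv_natCast_pow hN.le hk0]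
    have h2 : (1 / 25 : ℝ) ^ k = 2 ^ k / 50 ^ k := by rw [← div_pow]; norm_num
    rw [div_pow, h1, h2]
    apply le_of_eq
    field_simp
  have hbad := card_filter_absSpectralGap_lt_le (G := G) (k := k) (by omega) hG hs0
    (show 0 ≤ ε by positivity)
  have hsum := sum_one_div_valueCard_add_pow_le (G := G) hk (by omega)
    (show 0 ≤ 2 / s by positivity) hy
  rw [hsε] at hbad
  set S := ∑ χ ∈ Finset.univ.filter (fun χ : AddChar G ℂ => χ ≠ 0),
    (1 / (χ.valueCard : ℝ) + 2 / s) ^ k with hS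
  have hS0 : 0 ≤ S := Finset.sum_nonneg fun χ _ => by positivity
  have hbad2 : 2 * Real.exp (1 / 11) ^ k * S ≤ 10 * (2 : ℝ) ^ (-((k : ℝ) / 5)) := by
    have : Real.exp (1 / 11) ^ k * S ≤ (11 / 10) ^ k * S := by gcongr
    linarith
  have hpos : (0 : ℝ) < 2 ^ (-((k : ℝ) / 5)) := by positivity
  classical
  rw [tupleProb, Nat.card_eq_fintype_card, Fintype.card_subtype, hthr,
    le_div_iff₀ (by positivity)]
  have hcompl := Finset.card_filter_add_card_filter_not
    (s := (Finset.univ : Finset (Fin k → G))) fun Z => ε / 4 ≤ absSpectralGap (cayP Z)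
  simp only [not_le, Finset.card_univ, Fintype.card_fun, Fintype.card_fin] at hcompl
  have hcompl' : ((Finset.univ.filter fun Z : Fin k → G =>
      ε / 4 ≤ absSpectralGap (cayP Z)).card : ℝ) + ((Finset.univ.filter fun Z : Fin k → G =>
      absSpectralGap (cayP Z) < ε / 4).card : ℝ) = N ^ k := by
    rw [hNdef]; exact_mod_cast hcompl
  have hNk : 0 < N ^ k := by positivity
  have := mul_le_mul_of_nonneg_left hbad2 hNk.le
  nlinarith [mul_pos hNk hpos]
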